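/- arXiv:1408.4537 — 2 statements merged into one kernel-verified Lean document; each statement's English description precedes it below -/
import Mathlib

section
/- For octonions a, b, c, the trace satisfies tr((a*b)*c) = tr(a*(b*c)), where tr(x) = x + conj(x) = 2 Re(x). -/
open Matrix

noncomputable section

abbrev O := Fin 8 → ℝ

def e (i : Fin 8) : O := fun k => if k = i then 1 else 0

/-- Multiplication table: `tbl i j = (s, k)` means `e i * e j = s • e k`. -/
def tbl : Fin 8 → Fin 8 → ℤ × Fin 8 :=
  ![![(1,0),(1,1),(1,2),(1,3),(1,4),(1,5),(1,6),(1,7)],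
    ![(1,1),(-1,0),(1,4),(1,7),(-1,2),(1,6),(-1,5),(-1,3)],
    ![(1,2),(-1,4),(-1,0),(1,5),(1,1),(-1,3),(1,7),(-1,6)],
    ![(1,3),(-1,7),(-1,5),(-1,0),(1,6),(1,2),(-1,4),(1,1)],
    ![(1,4),(1,2),(-1,1),(-1,6),(-1,0),(1,7),(1,3),(-1,5)],
    ![(1,5),(-1,6),(1,3),(-1,2),(-1,7),(-1,0),(1,1),(1,4)],
    ![(1,6),(1,5),(-1,7),(1,4),(-1,3),(-1,1),(-1,0),(1,2)],
    ![(1,7),(1,3),(1,6),(-1,1),(1,5),(-1,4),(-1,2),(-1,0)]]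

/-- The octonion product. -/
def omul (x y : O) : O :=
  fun k => ∑ i : Fin 8, ∑ j : Fin 8,
    x i * y j * (if k = (tbl i j).2 then ((tbl i j).1 : ℝ) else 0)

/-- Octonion conjugation. -/
def oconj (x : O) : O := fun k => if k = 0 then x 0 else -x k

/-- The trace `tr x = x + conj x = 2 x₀`. -/
def otr (x : O) : ℝ := 2 * x 0

/-- The norm `N x = x₀² + ⋯ + x₇²`. -/
def oN (x : O) : ℝ := ∑ i : Fin 8, (x i) ^ 2

/-- The basis of the integral octaves. -/
def f : Fin 8 → O :=
  ![e 0, e 1, e 2, e 3,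
    ![0, 1/2, 1/2, 1/2, -1/2, 0, 0, 0],
    ![-1/2, -1/2, 0, 0, -1/2, 1/2, 0, 0],
    ![-1/2, 1/2, -1/2, 0, 0, 0, 1/2, 0],
    ![-1/2, 0, 1/2, 0, 1/2, 0, 0, 1/2]]

/-- An octave is integral if it is a ℤ-linear combination of `f 0, …, f 7`. -/
def IsIntegralOctave (x : O) : Prop := ∃ c : Fin 8 → ℤ, x = ∑ i : Fin 8, (c i : ℝ) • f i

/-- The matrix `P a = (tr(conj(eᵢ) * a * eₖ)/2)`. -/
def P (a : O) : Matrix (Fin 8) (Fin 8) ℝ :=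
  Matrix.of fun i k => otr (omul (omul (oconj (e i)) a) (e k)) / 2

/-- The matrix `Q a = (tr(conj(fᵢ) * a * fⱼ))`. -/
def Q (a : O) : Matrix (Fin 8) (Fin 8) ℝ :=
  Matrix.of fun i j => otr (omul (omul (oconj (f i)) a) (f j))

/-- The matrix whose rows are the coordinates of `f 0, …, f 7`. -/
def F : Matrix (Fin 8) (Fin 8) ℝ := Matrix.of fun i j => f i j

end

noncomputable section

theorem octonion_trace_assoc (a b c : O) :
    otr (omul (omul a b) c) = otr (omul a (omul b c)) := by
  simp [otr, omul, tbl, Fin.sum_univ_eight]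
  ring

end
end

section
/- The Gram matrix S = (tr(conj(f_i)*f_j))_{0≤i,j≤7} of the integral octaves with respect to the basis f_0,...,f_7 is an even symmetric integral matrix with determinant 1 (i.e. even unimodular), hence a Gram matrix of the E_8 lattice. -/
open Matrix

noncomputable section

/-- Twice the coordinates of the basis vectors, as integers. -/
def g : Fin 8 → Fin 8 → ℤ :=
  ![![2, 0, 0, 0, 0, 0, 0, 0], ![0, 2, 0, 0, 0, 0, 0, 0],
    ![0, 0, 2, 0, 0, 0, 0, 0], ![0, 0, 0, 2, 0, 0, 0, 0],
    ![0, 1, 1, 1, -1, 0, 0, 0],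
    ![-1, -1, 0, 0, -1, 1, 0, 0],
    ![-1, 1, -1, 0, 0, 0, 1, 0],
    ![-1, 0, 1, 0, 1, 0, 0, 1]]

lemma f_eq (i k : Fin 8) : f i k = (g i k : ℝ) / 2 := by
  fin_cases i <;> fin_cases k <;> simp [f, g, e]

lemma otr_eq (x y : O) : otr (omul (oconj x) y) = 2 * ∑ i, x i * y i := by
  simp [otr, omul, oconj, tbl, Fin.sum_univ_eight]

lemma gram_eq (i j : Fin 8) :
    otr (omul (oconj (f i)) (f j)) = ((∑ k, g i k * g j k : ℤ) : ℝ) / 2 := by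
  rw [otr_eq]
  push_cast
  rw [Finset.mul_sum, Finset.sum_div]
  refine Finset.sum_congr rfl fun k _ => ?_
  rw [f_eq, f_eq]
  ring

lemma det_F : F.det = -1 / 16 := by
  rw [Matrix.det_of_lowerTriangular]
  · simp only [F, Matrix.of_apply, f_eq, Fin.prod_univ_eight]
    simp [g]
    norm_num
  · intro i j hij
    have h : ∀ i j : Fin 8, i < j → g i j = 0 := by decide
    have hij' : i < j := hij
    simp [F, f_eq, h i j hij']

theorem gram_matrix_E8 :
    (∀ i j : Fin 8, ∃ z : ℤ, otr (omul (oconj (f i)) (f j)) = z) ∧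
    (∀ i j : Fin 8, otr (omul (oconj (f i)) (f j)) = otr (omul (oconj (f j)) (f i))) ∧
    (∀ i : Fin 8, ∃ z : ℤ, otr (omul (oconj (f i)) (f i)) = 2 * z) ∧
    (Matrix.of fun i j => otr (omul (oconj (f i)) (f j)) : Matrix (Fin 8) (Fin 8) ℝ).det = 1 := by
  refine ⟨fun i j => ?_, fun i j => ?_, fun i => ?_, ?_⟩
  · have h : ∀ i j : Fin 8, (2 : ℤ) ∣ ∑ k, g i k * g j k := by decide +kernel
    obtain ⟨z, hz⟩ := h i j
    exact ⟨z, by rw [gram_eq, hz]; push_cast; ring⟩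
  · rw [otr_eq, otr_eq]
    simp only [mul_comm]
  · have h : ∀ i : Fin 8, (4 : ℤ) ∣ ∑ k, g i k * g i k := by decide +kernel
    obtain ⟨z, hz⟩ := h i
    exact ⟨z, by rw [gram_eq, hz]; push_cast; ring⟩
  · have h : (Matrix.of fun i j => otr (omul (oconj (f i)) (f j)) : Matrix (Fin 8) (Fin 8) ℝ)
        = (2 : ℝ) • (F * Fᵀ) := by
      ext i j
      simp [otr_eq, Matrix.mul_apply, F]
    rw [h, Matrix.det_smul, Matrix.det_mul, Matrix.det_transpose, det_F]
    norm_num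

end
end
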